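/- arXiv:1608.04481 — 7 statements merged into one kernel-verified Lean document; each statement's English description precedes it below -/
import Mathlib

section
/- For every i : Fin m and j : Fin p, the (i,j) entry of the BasicMatrixMultiplication sketch is an unbiased estimator of the corresponding entry of the product, with explicitly computable variance: ∫ (CR(ω)) i j ∂μ = (A·B) i j, and ∫ ((CR(ω)) i j − (A·B) i j)² ∂μ = (1/c)·∑_{k : Fin n} (A i k)²·(B k j)²/(q k) − (1/c)·((A·B) i j)². -/
open MeasureTheory

/-- The `BasicMatrixMultiplication` sketch: given a sample `ω : Fin c → Fin n`, the
matrix `CR(ω) = ∑ t, (1/(c·q(ω t))) • (A^(ω t)) (B_(ω t))`, the sum of rescaled outer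
products of the sampled column–row pairs. -/
noncomputable def CRsketch {m n p c : ℕ} (A : Matrix (Fin m) (Fin n) ℝ)
    (B : Matrix (Fin n) (Fin p) ℝ) (q : Fin n → ℝ) (ω : Fin c → Fin n) :
    Matrix (Fin m) (Fin p) ℝ :=
  ∑ t : Fin c, (1 / ((c : ℝ) * q (ω t))) • Matrix.vecMulVec (fun i => A i (ω t)) (B (ω t))

/-- The contribution of the index `k` to the `(i, j)` entry of the sketch. -/
noncomputable def sampleTerm {m n p : ℕ} (c : ℕ) (A : Matrix (Fin m) (Fin n) ℝ)
    (B : Matrix (Fin n) (Fin p) ℝ) (q : Fin n → ℝ) (i : Fin m) (j : Fin p) (k : Fin n) : ℝ :=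
  1 / ((c : ℝ) * q k) * (A i k * B k j)

theorem CRsketch_apply {m n p c : ℕ} (A : Matrix (Fin m) (Fin n) ℝ)
    (B : Matrix (Fin n) (Fin p) ℝ) (q : Fin n → ℝ) (i : Fin m) (j : Fin p)
    (ω : Fin c → Fin n) :
    CRsketch A B q ω i j = ∑ t, sampleTerm c A B q i j (ω t) := by
  simp [CRsketch, sampleTerm, Matrix.sum_apply, Matrix.vecMulVec_apply]

theorem integral_eq_sum_of_measure_singleton {n : ℕ} {q : Fin n → ℝ} (hq : ∀ k, 0 < q k)
    {ν : Measure (Fin n)} [IsProbabilityMeasure ν] (hν : ∀ k, ν {k} = ENNReal.ofReal (q k))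
    (f : Fin n → ℝ) : ∫ k, f k ∂ν = ∑ k, q k * f k := by
  rw [integral_fintype .of_finite]
  simp [measureReal_def, hν, (hq _).le]

theorem integral_sampleTerm {m n p c : ℕ} (A : Matrix (Fin m) (Fin n) ℝ)
    (B : Matrix (Fin n) (Fin p) ℝ) {q : Fin n → ℝ} (hq : ∀ k, 0 < q k)
    {ν : Measure (Fin n)} [IsProbabilityMeasure ν] (hν : ∀ k, ν {k} = ENNReal.ofReal (q k))
    (i : Fin m) (j : Fin p) :
    ∫ k, sampleTerm c A B q i j k ∂ν = 1 / (c : ℝ) * (A * B) i j := by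
  rw [integral_eq_sum_of_measure_singleton hq hν, Matrix.mul_apply, Finset.mul_sum]
  refine Finset.sum_congr rfl fun k _ => ?_
  have := (hq k).ne'
  rw [sampleTerm]
  field_simp

theorem integral_sampleTerm_sq {m n p c : ℕ} (A : Matrix (Fin m) (Fin n) ℝ)
    (B : Matrix (Fin n) (Fin p) ℝ) {q : Fin n → ℝ} (hq : ∀ k, 0 < q k)
    {ν : Measure (Fin n)} [IsProbabilityMeasure ν] (hν : ∀ k, ν {k} = ENNReal.ofReal (q k))
    (i : Fin m) (j : Fin p) :
    ∫ k, sampleTerm c A B q i j k ^ 2 ∂ν =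
      1 / (c : ℝ) ^ 2 * ∑ k, A i k ^ 2 * B k j ^ 2 / q k := by
  rw [integral_eq_sum_of_measure_singleton hq hν, Finset.mul_sum]
  refine Finset.sum_congr rfl fun k _ => ?_
  have := (hq k).ne'
  rw [sampleTerm]
  field_simp

theorem stmt_0 {m n p c : ℕ} (hm : 0 < m) (hn : 0 < n) (hp : 0 < p) (hc : 0 < c)
    (A : Matrix (Fin m) (Fin n) ℝ) (B : Matrix (Fin n) (Fin p) ℝ)
    (q : Fin n → ℝ) (hq : ∀ k, 0 < q k) (hq1 : ∑ k, q k = 1)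
    (ν : Measure (Fin n)) [IsProbabilityMeasure ν]
    (hν : ∀ k, ν {k} = ENNReal.ofReal (q k))
    (μ : Measure (Fin c → Fin n)) (hμ : μ = Measure.pi fun _ => ν)
    (i : Fin m) (j : Fin p) :
    (∫ ω, CRsketch A B q ω i j ∂μ) = (A * B) i j ∧
    (∫ ω, (CRsketch A B q ω i j - (A * B) i j) ^ 2 ∂μ) =
      (1 / (c : ℝ)) * (∑ k, (A i k) ^ 2 * (B k j) ^ 2 / q k)
        - (1 / (c : ℝ)) * ((A * B) i j) ^ 2 := by
  subst hμ
  have hc0 : (c : ℝ) ≠ 0 := by exact_mod_cast hc.ne'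
  have hmean : ∫ ω, CRsketch A B q ω i j ∂(Measure.pi fun _ : Fin c => ν) = (A * B) i j := by
    simp_rw [CRsketch_apply]
    rw [integral_finsetSum _ fun _ _ => .of_finite]
    have heval (t : Fin c) : ∫ ω, sampleTerm c A B q i j (ω t) ∂(Measure.pi fun _ : Fin c => ν) =
        1 / (c : ℝ) * (A * B) i j := by
      rw [integral_comp_eval (μ := fun _ : Fin c => ν) (i := t) (f := sampleTerm c A B q i j)
        (Measurable.of_discrete).aestronglyMeasurable, integral_sampleTerm A B hq hν]
    simp only [heval, Finset.sum_const, Finset.card_univ, Fintype.card_fin, nsmul_eq_mul]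
    field_simp
  refine ⟨hmean, ?_⟩
  have hmem : MemLp (sampleTerm c A B q i j) 2 ν := .of_discrete
  have hvar := ProbabilityTheory.variance_sum_pi (μ := fun _ : Fin c => ν)
    (X := fun _ => sampleTerm c A B q i j) fun _ => hmem
  rw [ProbabilityTheory.variance_eq_integral Measurable.of_discrete.aemeasurable] at hvar
  simp only [Finset.sum_apply, ← CRsketch_apply, hmean] at hvar
  rw [hvar, ProbabilityTheory.variance_eq_sub hmem]
  simp only [Pi.pow_apply, integral_sampleTerm A B hq hν, integral_sampleTerm_sq A B hq hν,
    Finset.sum_const, Finset.card_univ, Fintype.card_fin, nsmul_eq_mul]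
  field_simp
end

section
/- Sampling probabilities proportional to the column–row norm products are optimal: for every q : Fin n → ℝ with q k > 0 for all k and ∑_k q k = 1, one has ∑_{k : Fin n} ‖A^(k)‖²·‖B_(k)‖²/(q k) ≥ (∑_{k : Fin n} ‖A^(k)‖·‖B_(k)‖)²; and if ‖A^(k)‖·‖B_(k)‖ > 0 for all k, then equality holds for the choice q k = ‖A^(k)‖·‖B_(k)‖ / ∑_{k'} ‖A^(k')‖·‖B_(k')‖. Hence this choice of probabilities minimizes the expected squared Frobenius error ∑_k ‖A^(k)‖²‖B_(k)‖²/(c·q k) − (1/c)‖A·B‖_F² of the BasicMatrixMultiplication sketch over all positive probability vectors. -/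
/-- Euclidean norm of a vector. -/
noncomputable def vecNorm {m : ℕ} (v : Fin m → ℝ) : ℝ :=
  Real.sqrt (∑ i, (v i) ^ 2)

/-- The weights proportional to `f` turn the Cauchy–Schwarz bound for `∑ k, f k ^ 2 / q k` into an
equality. -/
theorem sum_sq_div_div_sum {ι : Type*} [Fintype ι] (f : ι → ℝ) (hf : ∀ k, f k ≠ 0) :
    ∑ k, f k ^ 2 / (f k / ∑ j, f j) = (∑ k, f k) ^ 2 := by
  rw [sq (∑ k, f k), Finset.sum_mul]
  refine Finset.sum_congr rfl fun k _ => ?_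
  rw [div_div_eq_mul_div, sq, mul_assoc, mul_div_cancel_left₀ _ (hf k)]

theorem stmt_2 {m n p : ℕ} (hm : 0 < m) (hn : 0 < n) (hp : 0 < p)
    (A : Matrix (Fin m) (Fin n) ℝ) (B : Matrix (Fin n) (Fin p) ℝ) :
    (∀ q : Fin n → ℝ, (∀ k, 0 < q k) → (∑ k, q k) = 1 →
      (∑ k, vecNorm (fun i => A i k) ^ 2 * vecNorm (B k) ^ 2 / q k)
        ≥ (∑ k, vecNorm (fun i => A i k) * vecNorm (B k)) ^ 2) ∧
    ((∀ k, 0 < vecNorm (fun i => A i k) * vecNorm (B k)) →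
      (∑ k, vecNorm (fun i => A i k) ^ 2 * vecNorm (B k) ^ 2 /
          (vecNorm (fun i => A i k) * vecNorm (B k) /
            ∑ k', vecNorm (fun i => A i k') * vecNorm (B k')))
        = (∑ k, vecNorm (fun i => A i k) * vecNorm (B k)) ^ 2) := by
  simp only [← mul_pow]
  refine ⟨fun q hq hq1 => ?_, fun h => sum_sq_div_div_sum _ fun k => (h k).ne'⟩
  simpa [hq1] using Finset.sq_sum_div_le_sum_sq_div Finset.univ
    (fun k => vecNorm (fun i => A i k) * vecNorm (B k)) fun k _ => hq k
end

section
/- Suppose β ∈ (0,1], ‖A‖_F > 0, and the sampling probabilities depend only on the columns of A: q k ≥ β·‖A^(k)‖²/‖A‖_F² for every k. Then the expected squared Frobenius error of the BasicMatrixMultiplication sketch satisfies ∫ ‖A·B − CR(ω)‖_F² ∂μ ≤ (1/(β·c))·‖A‖_F²·‖B‖_F². -/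
open MeasureTheory

/-- Frobenius norm of a real matrix. -/
noncomputable def frobNorm {m p : ℕ} (M : Matrix (Fin m) (Fin p) ℝ) : ℝ :=
  Real.sqrt (∑ i, ∑ j, (M i j) ^ 2)

lemma frobNorm_sq {m p : ℕ} (M : Matrix (Fin m) (Fin p) ℝ) :
    frobNorm M ^ 2 = ∑ i, ∑ j, M i j ^ 2 :=
  Real.sq_sqrt (Finset.sum_nonneg fun _ _ => Finset.sum_nonneg fun _ _ => sq_nonneg _)

lemma vecNorm_sq {m : ℕ} (v : Fin m → ℝ) : vecNorm v ^ 2 = ∑ i, v i ^ 2 :=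
  Real.sq_sqrt (Finset.sum_nonneg fun _ _ => sq_nonneg _)

/-- The mean squared deviation of a sum of i.i.d. samples is at most the sum of second moments. -/
lemma integral_sq_sum_deviation_le {α : Type*} [Fintype α] [MeasurableSpace α]
    [MeasurableSingletonClass α] {c : ℕ} (ν : Measure α) [IsProbabilityMeasure ν] (g : α → ℝ) :
    (∫ ω, ((c : ℝ) * (∫ k, g k ∂ν) - ∑ t, g (ω t)) ^ 2 ∂Measure.pi fun _ : Fin c => ν) ≤
      c * ∫ k, g k ^ 2 ∂ν := by
  have hvar := ProbabilityTheory.variance_sum_pi (μ := fun _ : Fin c => ν) (X := fun _ => g)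
    fun _ => MemLp.of_discrete
  have hmean : (∫ ω, (∑ t, fun ω : Fin c → α => g (ω t)) ω ∂Measure.pi fun _ : Fin c => ν) =
      c * ∫ k, g k ∂ν := by
    simp only [Finset.sum_apply]
    rw [integral_finsetSum _ fun _ _ => Integrable.of_finite]
    simp [integral_comp_eval (μ := fun _ : Fin c => ν) (f := g) .of_discrete]
  rw [ProbabilityTheory.variance_eq_integral AEMeasurable.of_discrete, hmean] at hvar
  simp only [Finset.sum_apply] at hvar
  calc _ = c * ProbabilityTheory.variance g ν := by
        simpa [sub_sq_comm] using hvar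
    _ ≤ _ := by
        gcongr
        exact ProbabilityTheory.variance_le_expectation_sq .of_discrete

/-- The expected squared Frobenius error of the sketch, for arbitrary positive probabilities. -/
lemma integral_frobNorm_sq_sub_CRsketch_le {m n p c : ℕ} (hc : 0 < c)
    (A : Matrix (Fin m) (Fin n) ℝ) (B : Matrix (Fin n) (Fin p) ℝ)
    (q : Fin n → ℝ) (hq : ∀ k, 0 < q k) (ν : Measure (Fin n)) [IsProbabilityMeasure ν]
    (hν : ∀ k, ν {k} = ENNReal.ofReal (q k)) :
    (∫ ω, frobNorm (A * B - CRsketch A B q ω) ^ 2 ∂Measure.pi fun _ : Fin c => ν) ≤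
      ∑ k, 1 / (c * q k) * vecNorm (fun i => A i k) ^ 2 * vecNorm (B k) ^ 2 := by
  have hc' : (c : ℝ) ≠ 0 := by positivity
  have hint (f : Fin n → ℝ) : ∫ k, f k ∂ν = ∑ k, q k * f k := by
    rw [integral_fintype .of_finite]
    simp [measureReal_def, hν, ENNReal.toReal_ofReal (hq _).le]
  have hentry (i : Fin m) (j : Fin p) :
      (∫ ω, (A * B - CRsketch A B q ω) i j ^ 2 ∂Measure.pi fun _ : Fin c => ν) ≤
        ∑ k, 1 / (c * q k) * A i k ^ 2 * B k j ^ 2 := by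
    have h := integral_sq_sum_deviation_le (c := c) ν
      fun k => 1 / ((c : ℝ) * q k) * (A i k * B k j)
    have hmean : (c : ℝ) * ∑ k, q k * (1 / ((c : ℝ) * q k) * (A i k * B k j)) = (A * B) i j := by
      rw [Matrix.mul_apply, Finset.mul_sum]
      refine Finset.sum_congr rfl fun k _ => ?_
      have := (hq k).ne'
      field_simp
    have hsecond : (c : ℝ) * ∑ k, q k * (1 / ((c : ℝ) * q k) * (A i k * B k j)) ^ 2 =
        ∑ k, 1 / (c * q k) * A i k ^ 2 * B k j ^ 2 := by
      rw [Finset.mul_sum]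
      refine Finset.sum_congr rfl fun k _ => ?_
      have := (hq k).ne'
      field_simp
    rw [hint, hint, hmean, hsecond] at h
    simpa [CRsketch, Matrix.sum_apply, Matrix.vecMulVec_apply] using h
  simp only [frobNorm_sq, vecNorm_sq]
  rw [integral_finsetSum _ fun _ _ => Integrable.of_finite]
  simp only [integral_finsetSum _ fun _ _ => Integrable.of_finite]
  calc _ ≤ ∑ i, ∑ j, ∑ k, 1 / (c * q k) * A i k ^ 2 * B k j ^ 2 :=
        Finset.sum_le_sum fun i _ => Finset.sum_le_sum fun j _ => hentry i j
    _ = ∑ k, ∑ i, ∑ j, 1 / (c * q k) * A i k ^ 2 * B k j ^ 2 := by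
        rw [Finset.sum_comm (s := (Finset.univ : Finset (Fin n)))]
        exact Finset.sum_congr rfl fun i _ => Finset.sum_comm
    _ = _ := Finset.sum_congr rfl fun k _ => by
        rw [mul_assoc, Finset.sum_mul_sum, Finset.mul_sum]
        simp only [Finset.mul_sum, mul_assoc]

theorem stmt_5 {m n p c : ℕ} (hm : 0 < m) (hn : 0 < n) (hp : 0 < p) (hc : 0 < c)
    (A : Matrix (Fin m) (Fin n) ℝ) (B : Matrix (Fin n) (Fin p) ℝ)
    (q : Fin n → ℝ) (hq : ∀ k, 0 < q k) (hq1 : ∑ k, q k = 1)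
    (ν : Measure (Fin n)) [IsProbabilityMeasure ν]
    (hν : ∀ k, ν {k} = ENNReal.ofReal (q k))
    (μ : Measure (Fin c → Fin n)) (hμ : μ = Measure.pi fun _ => ν)
    (β : ℝ) (hβ : β ∈ Set.Ioc (0 : ℝ) 1)
    (hA : 0 < frobNorm A)
    (hprob : ∀ k, q k ≥ β * vecNorm (fun i => A i k) ^ 2 / frobNorm A ^ 2) :
    (∫ ω, frobNorm (A * B - CRsketch A B q ω) ^ 2 ∂μ) ≤
      (1 / (β * (c : ℝ))) * frobNorm A ^ 2 * frobNorm B ^ 2 := by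
  obtain ⟨hβ0, -⟩ := hβ
  subst hμ
  refine (integral_frobNorm_sq_sub_CRsketch_le hc A B q hq ν hν).trans ?_
  have hB : frobNorm B ^ 2 = ∑ k, vecNorm (B k) ^ 2 := by simp only [frobNorm_sq, vecNorm_sq]
  rw [hB, Finset.mul_sum]
  refine Finset.sum_le_sum fun k _ => mul_le_mul_of_nonneg_right ?_ (sq_nonneg _)
  have hk := (div_le_iff₀ (pow_pos hA 2)).1 (hprob k)
  have hqk := hq k
  rw [one_div_mul_eq_div, one_div_mul_eq_div, div_le_div_iff₀ (by positivity) (by positivity)]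
  nlinarith [mul_le_mul_of_nonneg_left hk (Nat.cast_nonneg (α := ℝ) c)]
end

section
/- Suppose the sampling probabilities are uniform, q k = 1/n for every k. Then the expected Frobenius error of the BasicMatrixMultiplication sketch satisfies ∫ ‖A·B − CR(ω)‖_F ∂μ ≤ √(n/c)·(∑_{k : Fin n} ‖A^(k)‖²·‖B_(k)‖²)^{1/2}. -/
open MeasureTheory

open ProbabilityTheory

/-- Sum of a function evaluated at `c` independent samples: its mean square deviation from the mean
is at most `c` times the second moment of the function. -/
lemma integral_sub_sum_eval_sq_le {c n : ℕ} (ν : Measure (Fin n)) [IsProbabilityMeasure ν]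
    (f : Fin n → ℝ) :
    ∫ ω, ((c : ℝ) * (∫ k, f k ∂ν) - ∑ t : Fin c, f (ω t)) ^ 2 ∂(Measure.pi fun _ : Fin c => ν) ≤
      c * ∫ k, f k ^ 2 ∂ν := by
  have hmean : ∫ ω, ∑ t : Fin c, f (ω t) ∂(Measure.pi fun _ : Fin c => ν) =
      c * ∫ k, f k ∂ν := by
    rw [integral_finsetSum _ fun _ _ => Integrable.of_finite]
    simp [integral_comp_eval (μ := fun _ : Fin c => ν) (f := f)
      (StronglyMeasurable.of_discrete.aestronglyMeasurable)]
  have hvar := variance_sum_pi (μ := fun _ : Fin c => ν) (X := fun _ => f)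
    (fun _ => MemLp.of_discrete)
  have hf : Var[f; ν] ≤ ∫ k, f k ^ 2 ∂ν :=
    variance_le_expectation_sq StronglyMeasurable.of_discrete.aestronglyMeasurable
  rw [variance_eq_integral Measurable.of_discrete.aemeasurable] at hvar
  simp only [Finset.sum_apply, hmean, Finset.sum_const, Finset.card_univ, Fintype.card_fin,
    nsmul_eq_mul] at hvar
  simp_rw [sub_sq_comm ((c : ℝ) * _)]
  rw [hvar]
  gcongr

/-- The expected squared Frobenius error of the sketch. -/
lemma integral_frobNorm_sub_CRsketch_sq_le {m n p c : ℕ} (hc : 0 < c)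
    (A : Matrix (Fin m) (Fin n) ℝ) (B : Matrix (Fin n) (Fin p) ℝ)
    (q : Fin n → ℝ) (hq : ∀ k, 0 < q k) (ν : Measure (Fin n)) [IsProbabilityMeasure ν]
    (hν : ∀ k, ν {k} = ENNReal.ofReal (q k)) :
    ∫ ω, frobNorm (A * B - CRsketch A B q ω) ^ 2 ∂(Measure.pi fun _ : Fin c => ν) ≤
      1 / c * ∑ k, vecNorm (fun i => A i k) ^ 2 * vecNorm (B k) ^ 2 / q k := by
  have hc' : (c : ℝ) ≠ 0 := by positivity
  have hreal : ∀ k, ν.real {k} = q k := fun k => by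
    rw [measureReal_def, hν, ENNReal.toReal_ofReal (hq k).le]
  have hentry : ∀ i j, ∫ ω, ((A * B - CRsketch A B q ω) i j) ^ 2
      ∂(Measure.pi fun _ : Fin c => ν) ≤ 1 / c * ∑ k, A i k ^ 2 * B k j ^ 2 / q k := by
    intro i j
    have h := integral_sub_sum_eval_sq_le (c := c) ν
      fun k => 1 / ((c : ℝ) * q k) * (A i k * B k j)
    simp only [integral_fintype (μ := ν) Integrable.of_finite, hreal, smul_eq_mul] at h
    have hmean : (c : ℝ) * ∑ k, q k * (1 / ((c : ℝ) * q k) * (A i k * B k j)) = (A * B) i j := by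
      rw [Matrix.mul_apply, Finset.mul_sum]
      refine Finset.sum_congr rfl fun k _ => ?_
      have := (hq k).ne'
      field_simp
    have hsq : (c : ℝ) * ∑ k, q k * (1 / ((c : ℝ) * q k) * (A i k * B k j)) ^ 2 =
        1 / c * ∑ k, A i k ^ 2 * B k j ^ 2 / q k := by
      rw [Finset.mul_sum, Finset.mul_sum]
      refine Finset.sum_congr rfl fun k _ => ?_
      have := (hq k).ne'
      field_simp
    rw [hmean, hsq] at h
    simpa only [CRsketch, Matrix.sub_apply, Matrix.sum_apply, Matrix.smul_apply,
      Matrix.vecMulVec_apply, smul_eq_mul] using h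
  have hfrob : ∀ M : Matrix (Fin m) (Fin p) ℝ, frobNorm M ^ 2 = ∑ i, ∑ j, M i j ^ 2 :=
    fun M => Real.sq_sqrt (by positivity)
  have hvec : ∀ {l : ℕ} (v : Fin l → ℝ), vecNorm v ^ 2 = ∑ i, v i ^ 2 :=
    fun v => Real.sq_sqrt (by positivity)
  simp only [hfrob, hvec]
  rw [integral_finsetSum _ fun _ _ => Integrable.of_finite]
  simp_rw [integral_finsetSum Finset.univ fun _ _ => Integrable.of_finite]
  refine (Finset.sum_le_sum fun i _ => Finset.sum_le_sum fun j _ => hentry i j).trans_eq ?_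
  simp_rw [← Finset.mul_sum, Finset.sum_mul_sum, Finset.sum_div]
  congr 1
  exact (Finset.sum_congr rfl fun i _ => Finset.sum_comm).trans Finset.sum_comm

theorem stmt_6 {m n p c : ℕ} (hm : 0 < m) (hn : 0 < n) (hp : 0 < p) (hc : 0 < c)
    (A : Matrix (Fin m) (Fin n) ℝ) (B : Matrix (Fin n) (Fin p) ℝ)
    (q : Fin n → ℝ) (hq : ∀ k, 0 < q k) (hq1 : ∑ k, q k = 1)
    (ν : Measure (Fin n)) [IsProbabilityMeasure ν]
    (hν : ∀ k, ν {k} = ENNReal.ofReal (q k))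
    (μ : Measure (Fin c → Fin n)) (hμ : μ = Measure.pi fun _ => ν)
    (huniform : ∀ k, q k = 1 / (n : ℝ)) :
    (∫ ω, frobNorm (A * B - CRsketch A B q ω) ∂μ) ≤
      Real.sqrt ((n : ℝ) / (c : ℝ)) *
        Real.sqrt (∑ k, vecNorm (fun i => A i k) ^ 2 * vecNorm (B k) ^ 2) := by
  subst hμ
  have hvar := variance_nonneg (fun ω => frobNorm (A * B - CRsketch A B q ω))
    (Measure.pi fun _ : Fin c => ν)
  rw [variance_eq_sub MemLp.of_discrete, sub_nonneg] at hvar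
  rw [← Real.sqrt_mul (by positivity)]
  refine Real.le_sqrt_of_sq_le (hvar.trans ?_)
  refine (integral_frobNorm_sub_CRsketch_sq_le hc A B q hq ν hν).trans_eq ?_
  simp only [huniform, div_div_eq_mul_div, div_one, ← Finset.sum_mul]
  ring
end

section
/- Matrix Markov inequality: let d ≥ 1, let X : Ω → Matrix (Fin d) (Fin d) ℝ be a random matrix that is entrywise integrable and such that X(ω) is positive semidefinite for every ω, and let A be a fixed positive definite d×d real matrix. Then μ{ω : ¬ (A − X(ω)).PosSemidef} ≤ Matrix.trace ((∫ X ∂μ) · A⁻¹). -/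
open MeasureTheory

open scoped Matrix MatrixOrder in
lemma Matrix.PosSemidef.exists_eq_transpose_mul_self {n : Type*} [Fintype n] [DecidableEq n]
    {X : Matrix n n ℝ} (hX : X.PosSemidef) : ∃ C : Matrix n n ℝ, X = Cᵀ * C := by
  obtain ⟨C, hC⟩ := CStarAlgebra.nonneg_iff_eq_star_mul_self.mp (nonneg_iff_posSemidef.mpr hX)
  exact ⟨C, by rw [hC, star_eq_conjTranspose, conjTranspose_eq_transpose_of_trivial]⟩

open scoped Matrix in
lemma Matrix.dotProduct_mulVec_transpose_mul_self {m n : Type*} [Fintype m] [Fintype n]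
    (C : Matrix m n ℝ) (v : n → ℝ) : v ⬝ᵥ ((Cᵀ * C) *ᵥ v) = ∑ i, (C *ᵥ v) i ^ 2 := by
  rw [← mulVec_mulVec, dotProduct_mulVec, vecMul_transpose]
  simp [dotProduct, sq]

open scoped Matrix in
lemma Matrix.sum_sq_mulVec_le {m n : Type*} [Fintype m] [Fintype n]
    (D : Matrix m n ℝ) (w : n → ℝ) :
    ∑ i, (D *ᵥ w) i ^ 2 ≤ (Dᵀ * D).trace * ∑ j, w j ^ 2 := by
  have htrace : (Dᵀ * D).trace = ∑ i, ∑ j, D i j ^ 2 := by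
    rw [Finset.sum_comm]
    simp [trace, mul_apply, sq]
  rw [htrace, Finset.sum_mul]
  exact Finset.sum_le_sum fun i _ => Finset.sum_mul_sq_le_sq_mul_sq _ _ _

open scoped Matrix in
/-- A positive semidefinite `X` satisfies `X ≤ tr (X * A⁻¹) • A` in the Loewner order, for every
positive definite `A`. -/
lemma Matrix.PosSemidef.dotProduct_mulVec_le_trace_mul_inv {n : Type*} [Fintype n] [DecidableEq n]
    {X A : Matrix n n ℝ} (hX : X.PosSemidef) (hA : A.PosDef) (v : n → ℝ) :
    v ⬝ᵥ (X *ᵥ v) ≤ (X * A⁻¹).trace * (v ⬝ᵥ (A *ᵥ v)) := by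
  obtain ⟨C, rfl⟩ := hX.exists_eq_transpose_mul_self
  obtain ⟨B, rfl⟩ := hA.posSemidef.exists_eq_transpose_mul_self
  have hB : IsUnit B.det := by
    have h := hA.det_pos.ne'
    rw [det_mul] at h
    exact (right_ne_zero_of_mul h).isUnit
  have htrace : ((C * B⁻¹)ᵀ * (C * B⁻¹)).trace = (Cᵀ * C * (Bᵀ * B)⁻¹).trace := by
    rw [mul_inv_rev, ← transpose_nonsing_inv, transpose_mul, Matrix.mul_assoc, trace_mul_comm]
    simp only [Matrix.mul_assoc]
  have hmul : (C * B⁻¹) *ᵥ (B *ᵥ v) = C *ᵥ v := by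
    rw [mulVec_mulVec, Matrix.mul_assoc, nonsing_inv_mul B hB, Matrix.mul_one]
  rw [dotProduct_mulVec_transpose_mul_self, dotProduct_mulVec_transpose_mul_self, ← htrace, ← hmul]
  exact sum_sq_mulVec_le _ _

lemma Matrix.PosSemidef.sub_of_trace_mul_inv_le_one {n : Type*} [Fintype n] [DecidableEq n]
    {X A : Matrix n n ℝ} (hX : X.PosSemidef) (hA : A.PosDef) (h : (X * A⁻¹).trace ≤ 1) :
    (A - X).PosSemidef := by
  refine .of_dotProduct_mulVec_nonneg (hA.isHermitian.sub hX.isHermitian) fun v => ?_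
  have hv := hX.dotProduct_mulVec_le_trace_mul_inv hA v
  have hAv := hA.posSemidef.dotProduct_mulVec_nonneg v
  rw [star_trivial] at hAv ⊢
  rw [sub_mulVec, dotProduct_sub]
  nlinarith

lemma Matrix.PosSemidef.trace_mul_nonneg {n : Type*} [Fintype n] [DecidableEq n]
    {X Y : Matrix n n ℝ} (hX : X.PosSemidef) (hY : Y.PosSemidef) : 0 ≤ (X * Y).trace := by
  obtain ⟨C, rfl⟩ := hX.exists_eq_transpose_mul_self
  rw [Matrix.mul_assoc, trace_mul_comm, ← conjTranspose_eq_transpose_of_trivial]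
  exact (hY.mul_mul_conjTranspose_same C).trace_nonneg

theorem stmt_7 {Ω : Type*} [MeasurableSpace Ω] (μ : Measure Ω) [IsProbabilityMeasure μ]
    {d : ℕ} (hd : 1 ≤ d)
    (X : Ω → Matrix (Fin d) (Fin d) ℝ)
    (hmeas : ∀ i j, Measurable fun ω => X ω i j)
    (hint : ∀ i j, Integrable (fun ω => X ω i j) μ)
    (hpsd : ∀ ω, (X ω).PosSemidef)
    (A : Matrix (Fin d) (Fin d) ℝ) (hA : A.PosDef) :
    μ {ω | ¬ (A - X ω).PosSemidef} ≤
      ENNReal.ofReal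
        (Matrix.trace ((Matrix.of fun i j => ∫ ω, X ω i j ∂μ) * A⁻¹)) := by
  have hterm (i j : Fin d) : Integrable (fun ω => X ω i j * A⁻¹ j i) μ := (hint i j).mul_const _
  have htr : (fun ω => (X ω * A⁻¹).trace) = fun ω => ∑ i, ∑ j, X ω i j * A⁻¹ j i := by
    ext ω
    simp [Matrix.trace, Matrix.mul_apply]
  have hf : Integrable (fun ω => (X ω * A⁻¹).trace) μ := by
    rw [htr]
    exact integrable_finsetSum _ fun i _ => integrable_finsetSum _ fun j _ => hterm i j
  have hexp : ∫ ω, (X ω * A⁻¹).trace ∂μ =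
      Matrix.trace ((Matrix.of fun i j => ∫ ω, X ω i j ∂μ) * A⁻¹) := by
    rw [htr, integral_finsetSum _ fun i _ => integrable_finsetSum _ fun j _ => hterm i j]
    simp_rw [integral_finsetSum _ fun j _ => hterm _ j, integral_mul_const]
    simp [Matrix.trace, Matrix.mul_apply]
  have hnonneg (ω : Ω) : 0 ≤ (X ω * A⁻¹).trace := (hpsd ω).trace_mul_nonneg hA.inv.posSemidef
  calc μ {ω | ¬ (A - X ω).PosSemidef}
      ≤ μ {ω | 1 ≤ (X ω * A⁻¹).trace} := measure_mono fun ω hω => by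
        contrapose! hω
        exact not_not.mpr ((hpsd ω).sub_of_trace_mul_inv_le_one hA (not_le.mp hω).le)
    _ ≤ ENNReal.ofReal (∫ ω, (X ω * A⁻¹).trace ∂μ) := by
        rw [← ofReal_measureReal]
        have := mul_meas_ge_le_integral_of_nonneg (.of_forall hnonneg) hf 1
        exact ENNReal.ofReal_le_ofReal (by simpa using this)
    _ = _ := by rw [hexp]
end

section
/- Randomized-Hadamard flattening of an orthonormal basis: with probability at least 1 − 1/20 over the random signs, every row of H·D(s)·U is flat: μ{s : ∀ i : Fin n, ‖(H·D(s)·U)_(i)‖² ≤ 2·d·log(40·n·d)/n} ≥ 19/20. -/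
open MeasureTheory Matrix
open scoped ENNReal

open ProbabilityTheory in
/-- A uniform random sign is sub-Gaussian with variance proxy `1`. -/
lemma hasSubgaussianMGF_id_rademacher :
    HasSubgaussianMGF id 1 ((1 / 2 : ℝ≥0∞) • Measure.dirac (-1 : ℝ) +
      (1 / 2 : ℝ≥0∞) • Measure.dirac (1 : ℝ)) where
  integrable_exp_mul t :=
    ((integrable_dirac (by simp)).smul_measure (by simp)).add_measure
      ((integrable_dirac (by simp)).smul_measure (by simp))
  mgf_le t := by
    rw [mgf, integral_add_measure ((integrable_dirac (by simp)).smul_measure (by simp))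
      ((integrable_dirac (by simp)).smul_measure (by simp))]
    have h := Real.cosh_le_exp_half_sq t
    rw [Real.cosh_eq] at h
    simp only [integral_smul_measure, integral_dirac, id, smul_eq_mul, ENNReal.toReal_div,
      ENNReal.toReal_one, ENNReal.toReal_ofNat, NNReal.coe_one, mul_neg, mul_one, one_mul]
    linarith

open ProbabilityTheory in
/-- Two-sided Hoeffding bound for a linear combination of independent sub-Gaussian variables. -/
lemma measureReal_le_abs_sum_mul_le {ι : Type*} [Fintype ι] {ν : Measure ℝ}
    [IsProbabilityMeasure ν] (hν : HasSubgaussianMGF id 1 ν) (a : ι → ℝ) {ε : ℝ} (hε : 0 ≤ ε) :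
    (Measure.pi fun _ : ι => ν).real {s | ε ≤ |∑ l, a l * s l|} ≤
      2 * Real.exp (-ε ^ 2 / (2 * ∑ l, a l ^ 2)) := by
  have hcoord (l : ι) : HasSubgaussianMGF (fun s : ι → ℝ => a l * s l)
      (‖a l‖₊ ^ 2) (Measure.pi fun _ : ι => ν) := by
    have heval : HasSubgaussianMGF (fun s : ι → ℝ => s l) 1 (Measure.pi fun _ : ι => ν) := by
      refine HasSubgaussianMGF.of_map (X := id) (measurable_pi_apply l).aemeasurable ?_
      rwa [(measurePreserving_eval (fun _ : ι => ν) l).map_eq]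
    convert heval.const_mul (a l) using 1
    refine Eq.trans (NNReal.eq ?_) (mul_one _).symm
    exact (congrArg (· ^ 2) (Real.norm_eq_abs _)).trans (sq_abs _)
  have hindep : iIndepFun (fun (l : ι) (s : ι → ℝ) => a l * s l)
      (Measure.pi fun _ : ι => ν) :=
    iIndepFun_pi (X := fun l x => a l * x) fun l => by fun_prop
  have hsum := HasSubgaussianMGF.sum_of_iIndepFun hindep (s := Finset.univ) fun l _ => hcoord l
  have hupper := hsum.measure_ge_le hε
  have hlower := hsum.neg.measure_ge_le hε
  simp only [NNReal.coe_sum, NNReal.coe_pow, coe_nnnorm, Real.norm_eq_abs, sq_abs,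
    Pi.neg_apply] at hupper hlower
  have hset : {s : ι → ℝ | ε ≤ |∑ l, a l * s l|} =
      {s | ε ≤ ∑ l, a l * s l} ∪ {s | ε ≤ -∑ l, a l * s l} := by
    ext s
    simp [le_abs]
  rw [hset, two_mul]
  exact (measureReal_union_le _ _).trans (add_le_add hupper hlower)

theorem stmt_12 {n d : ℕ} (hn : 1 ≤ n) (hd : 1 ≤ d)
    (U : Matrix (Fin n) (Fin d) ℝ) (hU : Uᵀ * U = 1)
    (H : Matrix (Fin n) (Fin n) ℝ)
    (hH : ∀ i l, |H i l| = 1 / Real.sqrt (n : ℝ))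
    (ν : Measure ℝ) [IsProbabilityMeasure ν]
    (hν : ν = (1 / 2 : ℝ≥0∞) • Measure.dirac (-1 : ℝ) +
      (1 / 2 : ℝ≥0∞) • Measure.dirac (1 : ℝ))
    (μ : Measure (Fin n → ℝ)) (hμ : μ = Measure.pi fun _ => ν) :
    μ {s | ∀ i : Fin n,
        vecNorm (fun j => (H * Matrix.diagonal s * U) i j) ^ 2 ≤
          2 * (d : ℝ) * Real.log (40 * (n : ℝ) * (d : ℝ)) / (n : ℝ)}
      ≥ 19 / 20 := by
  have hn' : (1 : ℝ) ≤ n := by exact_mod_cast hn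
  have hd' : (1 : ℝ) ≤ d := by exact_mod_cast hd
  have hnd : (1 : ℝ) ≤ n * d := one_le_mul_of_one_le_of_one_le hn' hd'
  set L := Real.log (40 * (n : ℝ) * (d : ℝ)) with hL
  have hL0 : 0 ≤ L := Real.log_nonneg (by linarith)
  set ε := Real.sqrt (2 * L / n) with hε
  have hε2 : ε ^ 2 = 2 * L / n := Real.sq_sqrt (by positivity)
  have : IsProbabilityMeasure μ := by rw [hμ]; infer_instance
  have hentry (s : Fin n → ℝ) (i : Fin n) (j : Fin d) :
      (H * Matrix.diagonal s * U) i j = ∑ l, H i l * U l j * s l := by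
    simp only [Matrix.mul_apply (M := H * Matrix.diagonal s), Matrix.mul_diagonal]
    exact Finset.sum_congr rfl fun l _ => by ring
  have hvar (i : Fin n) (j : Fin d) : ∑ l, (H i l * U l j) ^ 2 = 1 / n := by
    have hcol : ∑ l, U l j ^ 2 = 1 := by
      simpa [Matrix.mul_apply, sq] using congrFun (congrFun hU j) j
    have hH2 (l : Fin n) : H i l ^ 2 = 1 / n := by
      rw [← sq_abs, hH, div_pow, Real.sq_sqrt (by positivity), one_pow]
    simp_rw [mul_pow, hH2, ← Finset.mul_sum, hcol, mul_one]
  have htail (p : Fin n × Fin d) :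
      μ.real {s | ε ≤ |∑ l, H p.1 l * U l p.2 * s l|} ≤ 2 * (40 * (n : ℝ) * d)⁻¹ := by
    rw [hμ]
    refine (measureReal_le_abs_sum_mul_le (hν ▸ hasSubgaussianMGF_id_rademacher)
      (fun l => H p.1 l * U l p.2) (Real.sqrt_nonneg _)).trans_eq ?_
    have hexp : -ε ^ 2 / (2 * (1 / (n : ℝ))) = -L := by
      rw [hε2]
      field_simp
    rw [hvar, hexp, Real.exp_neg, hL, Real.exp_log (by positivity)]
  have hbad : μ.real (⋃ p : Fin n × Fin d, {s | ε ≤ |∑ l, H p.1 l * U l p.2 * s l|}) ≤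
      1 / 20 := by
    refine (measureReal_iUnion_fintype_le _).trans
      ((Finset.sum_le_sum fun p _ => htail p).trans_eq ?_)
    simp only [Finset.sum_const, Finset.card_univ, Fintype.card_prod, Fintype.card_fin,
      nsmul_eq_mul, Nat.cast_mul]
    field_simp
    norm_num
  have hmeas : MeasurableSet
      (⋃ p : Fin n × Fin d, {s : Fin n → ℝ | ε ≤ |∑ l, H p.1 l * U l p.2 * s l|}) :=
    MeasurableSet.iUnion fun p => measurableSet_le measurable_const (by fun_prop)
  have hgood : (⋃ p : Fin n × Fin d, {s : Fin n → ℝ | ε ≤ |∑ l, H p.1 l * U l p.2 * s l|})ᶜ ⊆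
      {s : Fin n → ℝ | ∀ i : Fin n, vecNorm (fun j => (H * Matrix.diagonal s * U) i j) ^ 2 ≤
        2 * (d : ℝ) * L / (n : ℝ)} := by
    intro s hs i
    simp only [Set.mem_compl_iff, Set.mem_iUnion, Set.mem_ofPred_eq, not_exists, not_le] at hs
    rw [vecNorm, Real.sq_sqrt (Finset.sum_nonneg fun _ _ => sq_nonneg _)]
    calc ∑ j, (H * Matrix.diagonal s * U) i j ^ 2 ≤ ∑ _j : Fin d, ε ^ 2 :=
          Finset.sum_le_sum fun j _ => by
            rw [hentry]
            exact sq_le_sq' (abs_le.1 (hs (i, j)).le).1 (abs_le.1 (hs (i, j)).le).2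
      _ = 2 * (d : ℝ) * L / n := by
          rw [hε2, Finset.sum_const, Finset.card_univ, Fintype.card_fin, nsmul_eq_mul]
          ring
  have hreal := measureReal_mono (μ := μ) hgood
  rw [probReal_compl_eq_one_sub hmeas] at hreal
  rw [ge_iff_le, ← ENNReal.toReal_le_toReal (by finiteness) (measure_ne_top _ _)]
  refine le_trans ?_ hreal
  rw [ENNReal.toReal_div]
  norm_num at hbad ⊢
  linarith
end

section
/- Main structural theorem for sketched low-rank approximation: under the stated SVD-split hypotheses, if Ω₁ = V₁ᵀ·S has full row rank (Ω₁·Ω₁ᵀ invertible) and Ω₁⁺ = Ω₁ᵀ·(Ω₁·Ω₁ᵀ)⁻¹, then for ‖·‖_ξ equal to either the Frobenius norm or the spectral norm, ‖A − (A·S)·Ω₁⁺·V₁ᵀ‖_ξ ≤ ‖A − U₁·Σ₁·V₁ᵀ‖_ξ + ‖Σ₂·Ω₂·Ω₁⁺‖_ξ, where Ω₂ = V₂ᵀ·S; i.e. the error of approximating A from its sketch A·S is at most the best rank-k error plus the interaction term ‖Σ₂Ω₂Ω₁⁺‖_ξ. -/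
open Matrix

/-- Spectral norm (`ℓ₂ → ℓ₂` operator norm, largest singular value) of a real matrix. -/
noncomputable def specNorm {m n : ℕ} (M : Matrix (Fin m) (Fin n) ℝ) : ℝ :=
  ‖(Matrix.toEuclideanLin M).toContinuousLinearMap‖

section FrobeniusNorm

open scoped Matrix.Norms.Frobenius

theorem frobNorm_eq_frobenius_norm {m p : ℕ} (M : Matrix (Fin m) (Fin p) ℝ) :
    frobNorm M = ‖M‖ := by
  simp [frobNorm, Matrix.frobenius_norm_def, Real.sqrt_eq_rpow]

theorem frobNorm_sub_le {m p : ℕ} (M N : Matrix (Fin m) (Fin p) ℝ) :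
    frobNorm (M - N) ≤ frobNorm M + frobNorm N := by
  simpa only [frobNorm_eq_frobenius_norm] using norm_sub_le M N

end FrobeniusNorm

theorem frobNorm_eq_sqrt_trace {m p : ℕ} (M : Matrix (Fin m) (Fin p) ℝ) :
    frobNorm M = Real.sqrt (Mᵀ * M).trace := by
  rw [frobNorm, Finset.sum_comm]
  simp [Matrix.trace, Matrix.mul_apply, sq]

theorem frobNorm_transpose {m p : ℕ} (M : Matrix (Fin m) (Fin p) ℝ) :
    frobNorm Mᵀ = frobNorm M := by
  simp only [frobNorm, Matrix.transpose_apply]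
  rw [Finset.sum_comm]

theorem frobNorm_mul_left_of_isometry {m p q : ℕ} {U : Matrix (Fin m) (Fin p) ℝ}
    (hU : Uᵀ * U = 1) (M : Matrix (Fin p) (Fin q) ℝ) :
    frobNorm (U * M) = frobNorm M := by
  rw [frobNorm_eq_sqrt_trace, frobNorm_eq_sqrt_trace, Matrix.transpose_mul, Matrix.mul_assoc,
    ← Matrix.mul_assoc Uᵀ, hU, Matrix.one_mul]

theorem frobNorm_mul_transpose_right_of_isometry {m p q : ℕ} {V : Matrix (Fin q) (Fin p) ℝ}
    (hV : Vᵀ * V = 1) (M : Matrix (Fin m) (Fin p) ℝ) :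
    frobNorm (M * Vᵀ) = frobNorm M := by
  rw [← frobNorm_transpose, Matrix.transpose_mul, Matrix.transpose_transpose,
    frobNorm_mul_left_of_isometry hV, frobNorm_transpose]

section SpectralNorm

open scoped Matrix.Norms.L2Operator

theorem specNorm_eq_l2_opNorm {m p : ℕ} (M : Matrix (Fin m) (Fin p) ℝ) :
    specNorm M = ‖M‖ := rfl

theorem specNorm_sub_le {m p : ℕ} (M N : Matrix (Fin m) (Fin p) ℝ) :
    specNorm (M - N) ≤ specNorm M + specNorm N := by
  simpa only [specNorm_eq_l2_opNorm] using norm_sub_le M N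

theorem specNorm_mul_le {m p q : ℕ} (M : Matrix (Fin m) (Fin p) ℝ)
    (N : Matrix (Fin p) (Fin q) ℝ) : specNorm (M * N) ≤ specNorm M * specNorm N := by
  simpa only [specNorm_eq_l2_opNorm] using Matrix.l2_opNorm_mul M N

theorem specNorm_nonneg {m p : ℕ} (M : Matrix (Fin m) (Fin p) ℝ) : 0 ≤ specNorm M :=
  norm_nonneg _

theorem specNorm_transpose {m p : ℕ} (M : Matrix (Fin m) (Fin p) ℝ) :
    specNorm Mᵀ = specNorm M := by
  rw [specNorm_eq_l2_opNorm, specNorm_eq_l2_opNorm, ← Matrix.conjTranspose_eq_transpose_of_trivial,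
    Matrix.l2_opNorm_conjTranspose]

theorem specNorm_one_le (p : ℕ) : specNorm (1 : Matrix (Fin p) (Fin p) ℝ) ≤ 1 := by
  rw [specNorm, Matrix.toLpLin_one]
  exact ContinuousLinearMap.norm_id_le

theorem specNorm_le_one_of_isometry {m p : ℕ} {U : Matrix (Fin m) (Fin p) ℝ}
    (hU : Uᵀ * U = 1) : specNorm U ≤ 1 := by
  have h := Matrix.l2_opNorm_conjTranspose_mul_self U
  rw [Matrix.conjTranspose_eq_transpose_of_trivial, hU] at h
  have h1 := specNorm_one_le p
  have h0 := specNorm_nonneg U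
  rw [specNorm_eq_l2_opNorm] at h0 h1 ⊢
  nlinarith

end SpectralNorm

theorem specNorm_mul_mul_transpose_le_of_isometry {m p q n : ℕ}
    {U : Matrix (Fin m) (Fin p) ℝ} {V : Matrix (Fin n) (Fin q) ℝ}
    (hU : Uᵀ * U = 1) (hV : Vᵀ * V = 1) (M : Matrix (Fin p) (Fin q) ℝ) :
    specNorm (U * M * Vᵀ) ≤ specNorm M :=
  calc specNorm (U * M * Vᵀ) ≤ specNorm (U * M) * specNorm Vᵀ := specNorm_mul_le _ _
    _ ≤ specNorm (U * M) := by
      rw [specNorm_transpose]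
      exact mul_le_of_le_one_right (specNorm_nonneg _) (specNorm_le_one_of_isometry hV)
    _ ≤ specNorm U * specNorm M := specNorm_mul_le _ _
    _ ≤ specNorm M :=
      mul_le_of_le_one_left (specNorm_nonneg _) (specNorm_le_one_of_isometry hU)

/-- The sketching error splits as the truncation error minus an interaction term, for any right
inverse `W` of `V₁ᵀ * S`. -/
theorem sub_sketch_eq {m n k r ℓ : ℕ} {A : Matrix (Fin m) (Fin n) ℝ}
    {U₁ : Matrix (Fin m) (Fin k) ℝ} {U₂ : Matrix (Fin m) (Fin r) ℝ}
    {V₁ : Matrix (Fin n) (Fin k) ℝ} {V₂ : Matrix (Fin n) (Fin r) ℝ}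
    {Sg₁ : Matrix (Fin k) (Fin k) ℝ} {Sg₂ : Matrix (Fin r) (Fin r) ℝ}
    (hA : A = U₁ * Sg₁ * V₁ᵀ + U₂ * Sg₂ * V₂ᵀ)
    {S : Matrix (Fin n) (Fin ℓ) ℝ} {W : Matrix (Fin ℓ) (Fin k) ℝ} (hW : V₁ᵀ * S * W = 1) :
    A - A * S * W * V₁ᵀ =
      (A - U₁ * Sg₁ * V₁ᵀ) - U₂ * (Sg₂ * (V₂ᵀ * S) * W) * V₁ᵀ := by
  have h : A * S * W = U₁ * Sg₁ + U₂ * (Sg₂ * (V₂ᵀ * S) * W) := by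
    calc A * S * W = U₁ * Sg₁ * (V₁ᵀ * S * W) + U₂ * (Sg₂ * (V₂ᵀ * S) * W) := by
          rw [hA]; simp only [Matrix.add_mul, Matrix.mul_assoc]
      _ = _ := by rw [hW, Matrix.mul_one]
  rw [h, Matrix.add_mul, sub_sub]

theorem stmt_18 {m n k r ℓ : ℕ}
    (hm : 0 < m) (hn : 0 < n) (hk : 0 < k) (hr : 0 < r) (hℓ : 0 < ℓ)
    (A : Matrix (Fin m) (Fin n) ℝ)
    (U₁ : Matrix (Fin m) (Fin k) ℝ) (U₂ : Matrix (Fin m) (Fin r) ℝ)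
    (V₁ : Matrix (Fin n) (Fin k) ℝ) (V₂ : Matrix (Fin n) (Fin r) ℝ)
    (Sg₁ : Matrix (Fin k) (Fin k) ℝ) (Sg₂ : Matrix (Fin r) (Fin r) ℝ)
    (hA : A = U₁ * Sg₁ * V₁ᵀ + U₂ * Sg₂ * V₂ᵀ)
    (hU₁ : U₁ᵀ * U₁ = 1) (hU₂ : U₂ᵀ * U₂ = 1)
    (hV₁ : V₁ᵀ * V₁ = 1) (hV₂ : V₂ᵀ * V₂ = 1)
    (hU₁₂ : U₁ᵀ * U₂ = 0) (hV₁₂ : V₁ᵀ * V₂ = 0)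
    (S : Matrix (Fin n) (Fin ℓ) ℝ)
    (hfull : IsUnit ((V₁ᵀ * S) * (V₁ᵀ * S)ᵀ)) :
    (frobNorm (A - (A * S) * ((V₁ᵀ * S)ᵀ * ((V₁ᵀ * S) * (V₁ᵀ * S)ᵀ)⁻¹) * V₁ᵀ) ≤
        frobNorm (A - U₁ * Sg₁ * V₁ᵀ) +
          frobNorm (Sg₂ * (V₂ᵀ * S) * ((V₁ᵀ * S)ᵀ * ((V₁ᵀ * S) * (V₁ᵀ * S)ᵀ)⁻¹))) ∧
    (specNorm (A - (A * S) * ((V₁ᵀ * S)ᵀ * ((V₁ᵀ * S) * (V₁ᵀ * S)ᵀ)⁻¹) * V₁ᵀ) ≤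
        specNorm (A - U₁ * Sg₁ * V₁ᵀ) +
          specNorm (Sg₂ * (V₂ᵀ * S) * ((V₁ᵀ * S)ᵀ * ((V₁ᵀ * S) * (V₁ᵀ * S)ᵀ)⁻¹))) := by
  have hW : V₁ᵀ * S * ((V₁ᵀ * S)ᵀ * ((V₁ᵀ * S) * (V₁ᵀ * S)ᵀ)⁻¹) = 1 := by
    rw [← Matrix.mul_assoc]
    exact Matrix.mul_nonsing_inv _ ((Matrix.isUnit_iff_isUnit_det _).mp hfull)
  rw [sub_sketch_eq hA hW]
  constructor
  · refine (frobNorm_sub_le _ _).trans_eq ?_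
    rw [frobNorm_mul_transpose_right_of_isometry hV₁, frobNorm_mul_left_of_isometry hU₂]
  · refine (specNorm_sub_le _ _).trans ?_
    gcongr
    exact specNorm_mul_mul_transpose_le_of_isometry hU₂ hV₁ _
end
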